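/- arXiv:1112.2122 — 9 statements merged into one kernel-verified Lean document; each statement's English description precedes it below -/
import Mathlib

section
/- Let A be a unital ring, δ : A → A a derivation, B a unital ring, f : A → B a ring homomorphism, and ξ ∈ B with ξ·f(a) = f(a)·ξ + f(δ(a)) for all a ∈ A. Then for all families a_0,…,a_M ∈ A and b_0,…,b_N ∈ A one has the multiplication formula (Σ_{i=0}^{M} f(a_i)·ξ^i)·(Σ_{j=0}^{N} f(b_j)·ξ^j) = Σ_{n=0}^{M+N} ( Σ f(a_i · δ^k(b_j)) · C(i,k) ) · ξ^n, where the inner sum is over all integers 0 ≤ k ≤ i ≤ M and 0 ≤ j ≤ N with i + j − k = n. -/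
/-- Moving a power of `ξ` past `f b`. This is the binomial theorem for left multiplication by `ξ`,
written as the sum of the commuting operators `[ξ, ·]` and right multiplication by `ξ`. -/
theorem pow_mul_map_eq_sum_iterate {A B : Type*} [Semiring A] [Ring B] (δ : A → A) (f : A →+* B)
    (ξ : B) (hξ : ∀ a : A, ξ * f a = f a * ξ + f (δ a)) (i : ℕ) (b : A) :
    ξ ^ i * f b =
      ∑ k ∈ Finset.range (i + 1), f (δ^[k] b) * (i.choose k : B) * ξ ^ (i - k) := by
  set L := LinearMap.mulLeft ℤ ξ with hL
  set R := LinearMap.mulRight ℤ ξ with hR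
  have hLR : Commute L R := LinearMap.commute_mulLeft_right ξ ξ
  have hcomm : Commute R (L - R) := hLR.symm.sub_right (Commute.refl R)
  have had (k : ℕ) : ((L - R) ^ k) (f b) = f (δ^[k] b) := by
    induction k with
    | zero => simp
    | succ k ih =>
      rw [pow_succ', Module.End.mul_apply, ih, Function.iterate_succ_apply']
      simp [hL, hR, hξ]
  have hbinom := congrArg (fun T : Module.End ℤ B => T (f b)) (hcomm.symm.add_pow i)
  simp only [sub_add_cancel] at hbinom
  rw [hL, LinearMap.pow_mulLeft, LinearMap.mulLeft_apply, ← hL] at hbinom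
  rw [hbinom, LinearMap.sum_apply]
  refine Finset.sum_congr rfl fun k _ => ?_
  rw [← (hcomm.pow_pow (i - k) k).eq, ← (Nat.cast_commute (i.choose k) _).eq,
    Module.End.mul_apply, Module.End.mul_apply, had, hR, LinearMap.pow_mulRight,
    LinearMap.mulRight_apply, Module.End.natCast_apply, nsmul_eq_mul, ← mul_assoc,
    (Nat.cast_commute (i.choose k) (f (δ^[k] b))).eq]

/-- Multiplication formula in the algebra of formal differential symbols:
`(∑_{i=0}^{M} f(a i) ξ^i) * (∑_{j=0}^{N} f(b j) ξ^j)
  = ∑_{n=0}^{M+N} (∑_{0 ≤ k ≤ i ≤ M, 0 ≤ j ≤ N, i+j-k=n} f(a i * δ^[k] (b j)) * C(i,k)) * ξ^n`. -/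
theorem diff_symbols_mul_formula
    {A B : Type*} [Ring A] [Ring B]
    (δ : A → A)
    (hδadd : ∀ a b : A, δ (a + b) = δ a + δ b)
    (hδmul : ∀ a b : A, δ (a * b) = δ a * b + a * δ b)
    (f : A →+* B) (ξ : B)
    (hξ : ∀ a : A, ξ * f a = f a * ξ + f (δ a))
    (M N : ℕ) (a : ℕ → A) (b : ℕ → A) :
    (∑ i ∈ Finset.range (M + 1), f (a i) * ξ ^ i) *
      (∑ j ∈ Finset.range (N + 1), f (b j) * ξ ^ j) =
    ∑ n ∈ Finset.range (M + N + 1),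
      (∑ i ∈ Finset.range (M + 1), ∑ j ∈ Finset.range (N + 1),
        ∑ k ∈ Finset.range (i + 1),
          if i + j = n + k then f (a i * δ^[k] (b j)) * (i.choose k : B) else 0) *
      ξ ^ n := by
  simp_rw [Finset.sum_mul, Finset.mul_sum]
  conv_rhs => rw [Finset.sum_comm]
  refine Finset.sum_congr rfl fun i hi => ?_
  conv_rhs => rw [Finset.sum_comm]
  refine Finset.sum_congr rfl fun j hj => ?_
  conv_rhs => rw [Finset.sum_comm]
  rw [mul_assoc, ← mul_assoc (ξ ^ i),
    pow_mul_map_eq_sum_iterate δ f ξ hξ, Finset.sum_mul, Finset.mul_sum]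
  refine Finset.sum_congr rfl fun k hk => ?_
  rw [Finset.mem_range] at hi hj hk
  rw [Finset.sum_eq_single_of_mem (i - k + j) (Finset.mem_range.2 (by omega))
    fun n _ hn => by rw [if_neg (by omega), zero_mul]]
  rw [if_pos (by omega), map_mul, pow_add]
  simp only [mul_assoc]
end

section
/- Let A be a unital ring, σ : A → A a ring automorphism, δ : A → A a σ-derivation, B a unital ring, f : A → B a ring homomorphism, and ξ an invertible element (unit) of B with ξ·f(a) = f(σ(a))·ξ + f(δ(a)) for all a ∈ A. Then for every a ∈ A and every natural number N one has ξ^{-1}·f(a) = Σ_{i=0}^{N} (−1)^i · f( σ^{-1}((δ∘σ^{-1})^i(a)) ) · ξ^{-1-i} + (−1)^{N+1} · ξ^{-1} · f( (δ∘σ^{-1})^{N+1}(a) ) · ξ^{-1-N}. -/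
/-- Commuting `ξ⁻¹` past `f b` once, with the remainder on the right. -/
theorem inv_mul_map_eq_sub_of_twisted_comm
    {A B : Type*} [Ring A] [Ring B] (σ : A ≃+* A) (δ : A → A) (f : A →+* B) (ξ : Bˣ)
    (hξ : ∀ a : A, (ξ : B) * f a = f (σ a) * (ξ : B) + f (δ a)) (b : A) :
    (↑ξ⁻¹ : B) * f b =
      f (σ.symm b) * (↑ξ⁻¹ : B) - (↑ξ⁻¹ : B) * f (δ (σ.symm b)) * (↑ξ⁻¹ : B) := by
  have hb : f b * (ξ : B) = ξ * f (σ.symm b) - f (δ (σ.symm b)) := by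
    rw [hξ, σ.apply_symm_apply, add_sub_cancel_right]
  rw [← sub_mul, Units.eq_mul_inv_iff_mul_eq, mul_assoc, hb, mul_sub, Units.inv_mul_cancel_left]

/-- Twisted version: for a ring automorphism `σ`, a `σ`-derivation `δ`, and an
invertible `ξ` with `ξ * f a = f (σ a) * ξ + f (δ a)`, one has, for every natural number `N`,
`ξ⁻¹ * f a = ∑_{i=0}^{N} (-1)^i * f (σ⁻¹ ((δ∘σ⁻¹)^[i] a)) * ξ^{-1-i}
             + (-1)^{N+1} * ξ⁻¹ * f ((δ∘σ⁻¹)^[N+1] a) * ξ^{-1-N}`. -/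
theorem xi_inv_mul_comm_twisted
    {A B : Type*} [Ring A] [Ring B]
    (σ : A ≃+* A) (δ : A → A)
    (hδadd : ∀ a b : A, δ (a + b) = δ a + δ b)
    (hδmul : ∀ a b : A, δ (a * b) = δ a * b + σ a * δ b)
    (f : A →+* B) (ξ : Bˣ)
    (hξ : ∀ a : A, (ξ : B) * f a = f (σ a) * (ξ : B) + f (δ a)) :
    ∀ (a : A) (N : ℕ),
      (↑ξ⁻¹ : B) * f a =
        (∑ i ∈ Finset.range (N + 1),
          (-1 : B) ^ i * f (σ.symm ((δ ∘ ⇑σ.symm)^[i] a)) * (↑ξ⁻¹ : B) ^ (i + 1)) +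
        (-1 : B) ^ (N + 1) * (↑ξ⁻¹ : B) * f ((δ ∘ ⇑σ.symm)^[N + 1] a) *
          (↑ξ⁻¹ : B) ^ (N + 1) := by
  intro a N
  induction N with
  | zero =>
    simpa [sub_eq_add_neg] using inv_mul_map_eq_sub_of_twisted_comm σ δ f ξ hξ a
  | succ n ih =>
    rw [ih, Finset.sum_range_succ _ (n + 1), add_assoc]
    congr 1
    rw [mul_assoc ((-1 : B) ^ (n + 1)),
      inv_mul_map_eq_sub_of_twisted_comm σ δ f ξ hξ ((δ ∘ ⇑σ.symm)^[n + 1] a),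
      Function.iterate_succ_apply' _ (n + 1), Function.comp_apply,
      pow_succ (-1 : B) (n + 1), pow_succ' (↑ξ⁻¹ : B) (n + 1)]
    noncomm_ring
end

section
/- Let A be a unital ring, σ : A → A a ring automorphism, and δ : A → A a σ-derivation satisfying δ∘σ = σ∘δ. Let B be a unital ring, f : A → B a ring homomorphism, and ξ ∈ B with ξ·f(a) = f(σ(a))·ξ + f(δ(a)) for all a ∈ A. Then for every natural number n and every a ∈ A one has ξ^n · f(a) = Σ_{j=0}^{n} C(n,j) · f( σ^{n-j}(δ^j(a)) ) · ξ^{n-j}. -/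
/-- For a ring automorphism `σ`, a `σ`-derivation `δ` commuting with `σ`, and
`ξ ∈ B` with `ξ * f a = f (σ a) * ξ + f (δ a)`, one has
`ξ ^ n * f a = ∑_{j=0}^{n} C(n,j) * f (σ^{n-j} (δ^[j] a)) * ξ ^ (n - j)`. -/
theorem xi_pow_mul_comm_twisted
    {A B : Type*} [Ring A] [Ring B]
    (σ : A ≃+* A) (δ : A → A)
    (hδadd : ∀ a b : A, δ (a + b) = δ a + δ b)
    (hδmul : ∀ a b : A, δ (a * b) = δ a * b + σ a * δ b)
    (hcomm : ∀ a : A, δ (σ a) = σ (δ a))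
    (f : A →+* B) (ξ : B)
    (hξ : ∀ a : A, ξ * f a = f (σ a) * ξ + f (δ a)) :
    ∀ (n : ℕ) (a : A),
      ξ ^ n * f a =
        ∑ j ∈ Finset.range (n + 1),
          (n.choose j : B) * f ((σ ^ (n - j)) (δ^[j] a)) * ξ ^ (n - j) := by
  have hiter : ∀ (j : ℕ) (a : A), δ^[j] (σ a) = σ (δ^[j] a) := fun j a =>
    (Function.Commute.iterate_left (f := δ) (g := σ) hcomm j) a
  intro n
  induction n with
  | zero => intro a; simp
  | succ n ih =>
    intro a
    have hσ : ξ ^ n * f (σ a) * ξ = ∑ j ∈ Finset.range (n + 1 + 1),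
        (n.choose j : B) * f ((σ ^ (n + 1 - j)) (δ^[j] a)) * ξ ^ (n + 1 - j) := by
      rw [ih, Finset.sum_mul, Finset.sum_range_succ _ (n + 1), Nat.choose_succ_self,
        Nat.cast_zero, zero_mul, zero_mul, add_zero]
      refine Finset.sum_congr rfl fun j hj => ?_
      rw [Nat.succ_sub (Finset.mem_range_succ_iff.mp hj), pow_succ, pow_succ, hiter,
        RingAut.mul_apply, mul_assoc _ (ξ ^ (n - j))]
    rw [pow_succ, mul_assoc, hξ, mul_add, ← mul_assoc, hσ, ih, Finset.sum_range_succ',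
      Finset.sum_range_succ' _ (n + 1), add_right_comm, ← Finset.sum_add_distrib]
    congr 1
    · refine Finset.sum_congr rfl fun j _ => ?_
      rw [Nat.add_sub_add_right, Function.iterate_succ_apply, Nat.choose_succ_succ,
        Nat.cast_add, add_mul, add_mul, add_comm]
    · rw [Nat.choose_zero_right, Nat.choose_zero_right]
end

section
/- Let A be a unital ring, σ : A → A a ring automorphism, and δ₁, δ₂ : A → A two σ-derivations such that δ₁∘δ₂ = δ₂∘δ₁, δ₁∘σ = σ∘δ₁, and δ₂∘σ = σ∘δ₂. Let B be a unital ring, f : A → B a ring homomorphism, and ξ₁, ξ₂ ∈ B with ξ₁ξ₂ = ξ₂ξ₁ and ξ_r·f(a) = f(σ(a))·ξ_r + f(δ_r(a)) for r = 1,2 and all a ∈ A. Then for all natural numbers m, n and all a ∈ A one has ξ₁^m ξ₂^n · f(a) = Σ_{i=0}^{m} Σ_{j=0}^{n} C(m,i)·C(n,j) · f( σ^{m+n-i-j}(δ₁^i(δ₂^j(a))) ) · ξ₁^{m-i} ξ₂^{n-j}. -/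
open Finset in
/-- One-dimensional commutation formula, for a single `ξ` and `δ` commuting with `σ`. -/
theorem xi_pow_mul_map {A B : Type*} [Ring A] [Ring B] (σ : A ≃+* A) (δ : A → A)
    (hδσ : ∀ a, δ (σ a) = σ (δ a)) (f : A →+* B) (ξ : B)
    (hξ : ∀ a, ξ * f a = f (σ a) * ξ + f (δ a)) (m : ℕ) (a : A) :
    ξ ^ m * f a =
      ∑ i ∈ range (m + 1), (m.choose i : B) * (f ((σ ^ (m - i)) (δ^[i] a)) * ξ ^ (m - i)) := by
  rw [← Nat.sum_antidiagonal_eq_sum_range_succ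
    (fun i j => (m.choose i : B) * (f ((σ ^ j) (δ^[i] a)) * ξ ^ j))]
  induction m generalizing a with
  | zero => simp
  | succ m ih =>
    rw [sum_antidiagonal_choose_succ_mul (fun i j => f ((σ ^ j) (δ^[i] a)) * ξ ^ j),
      pow_succ, mul_assoc, hξ, mul_add, ← mul_assoc, ih, ih, sum_mul]
    congr 1
    · refine sum_congr rfl fun p _ => ?_
      have hcomm : δ^[p.1] (σ a) = σ (δ^[p.1] a) :=
        (Function.Commute.iterate_left (f := δ) (g := σ) hδσ p.1) a
      rw [hcomm, pow_succ σ, pow_succ ξ, RingAut.mul_apply]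
      simp only [mul_assoc]
    · refine sum_congr rfl fun p hp => ?_
      rw [Function.iterate_succ_apply, Nat.choose_symm_of_eq_add]
      rw [← mem_antidiagonal.mp hp, add_comm]

/-- Two-dimensional commutation formula: for a ring automorphism `σ`, two
commuting `σ`-derivations `δ₁, δ₂` commuting with `σ`, and commuting `ξ₁, ξ₂ ∈ B` with
`ξᵣ * f a = f (σ a) * ξᵣ + f (δᵣ a)`, one has
`ξ₁^m * ξ₂^n * f a
  = ∑_{i=0}^{m} ∑_{j=0}^{n} C(m,i) C(n,j) f (σ^{m+n-i-j} (δ₁^[i] (δ₂^[j] a))) ξ₁^{m-i} ξ₂^{n-j}`. -/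
theorem xi_pow_two_dim_comm
    {A B : Type*} [Ring A] [Ring B]
    (σ : A ≃+* A) (δ₁ δ₂ : A → A)
    (hδ₁add : ∀ a b : A, δ₁ (a + b) = δ₁ a + δ₁ b)
    (hδ₂add : ∀ a b : A, δ₂ (a + b) = δ₂ a + δ₂ b)
    (hδ₁mul : ∀ a b : A, δ₁ (a * b) = δ₁ a * b + σ a * δ₁ b)
    (hδ₂mul : ∀ a b : A, δ₂ (a * b) = δ₂ a * b + σ a * δ₂ b)
    (hδδ : ∀ a : A, δ₁ (δ₂ a) = δ₂ (δ₁ a))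
    (hδ₁σ : ∀ a : A, δ₁ (σ a) = σ (δ₁ a))
    (hδ₂σ : ∀ a : A, δ₂ (σ a) = σ (δ₂ a))
    (f : A →+* B) (ξ₁ ξ₂ : B)
    (hξξ : ξ₁ * ξ₂ = ξ₂ * ξ₁)
    (hξ₁ : ∀ a : A, ξ₁ * f a = f (σ a) * ξ₁ + f (δ₁ a))
    (hξ₂ : ∀ a : A, ξ₂ * f a = f (σ a) * ξ₂ + f (δ₂ a)) :
    ∀ (m n : ℕ) (a : A),
      ξ₁ ^ m * ξ₂ ^ n * f a =
        ∑ i ∈ Finset.range (m + 1), ∑ j ∈ Finset.range (n + 1),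
          (m.choose i : B) * (n.choose j : B) *
            f ((σ ^ (m + n - i - j)) (δ₁^[i] (δ₂^[j] a))) *
            (ξ₁ ^ (m - i) * ξ₂ ^ (n - j)) := by
  intro m n a
  rw [mul_assoc, xi_pow_mul_map σ δ₂ hδ₂σ f ξ₂ hξ₂, Finset.mul_sum, Finset.sum_comm]
  refine Finset.sum_congr rfl fun j hj => ?_
  rw [(Nat.cast_commute (n.choose j) (ξ₁ ^ m)).symm.left_comm, ← mul_assoc (ξ₁ ^ m),
    xi_pow_mul_map σ δ₁ hδ₁σ f ξ₁ hξ₁, Finset.sum_mul, Finset.mul_sum]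
  refine Finset.sum_congr rfl fun i hi => ?_
  have hcomm : δ₁^[i] ((σ ^ (n - j)) (δ₂^[j] a)) = (σ ^ (n - j)) (δ₁^[i] (δ₂^[j] a)) := by
    rw [RingAut.coe_pow]
    exact (Function.Commute.iterate_iterate (f := δ₁) (g := σ) hδ₁σ i (n - j)) _
  have hexp : m + n - i - j = (m - i) + (n - j) := by
    rw [Finset.mem_range] at hi hj
    omega
  rw [hcomm, hexp, pow_add, RingAut.mul_apply, (Nat.cast_commute (m.choose i) (n.choose j : B)).eq]
  simp only [mul_assoc]
end

section
/- Let A be a unital ring, σ : A → A a ring automorphism, and δ₁, δ₂ : A → A two σ-derivations such that δ₁∘δ₂ = δ₂∘δ₁, δ₁∘σ = σ∘δ₁, and δ₂∘σ = σ∘δ₂. Let B be a unital ring, f : A → B a ring homomorphism, and ξ₁, ξ₂ ∈ B with ξ₁ξ₂ = ξ₂ξ₁ and ξ_r·f(a) = f(σ(a))·ξ_r + f(δ_r(a)) for r = 1,2 and all a ∈ A. Then for all natural numbers m, n, p, q and all a, b ∈ A one has the product formula f(a)·ξ₁^m ξ₂^n · f(b)·ξ₁^p ξ₂^q = Σ_{i=0}^{m}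 Σ_{j=0}^{n} C(m,i)·C(n,j) · f( a · σ^{m+n-i-j}(δ₁^i(δ₂^j(b))) ) · ξ₁^{m+p-i} ξ₂^{n+q-j}. -/
/-- A map commuting with `σ` has iterates commuting with the powers of `σ`. -/
theorem iterate_ringEquiv_pow_apply {A : Type*} [Ring A] (σ : A ≃+* A) (δ : A → A)
    (hδσ : ∀ a : A, δ (σ a) = σ (δ a)) (i k : ℕ) (a : A) :
    δ^[i] ((σ ^ k) a) = (σ ^ k) (δ^[i] a) := by
  induction k generalizing a with
  | zero => simp
  | succ k ih =>
    rw [pow_succ, RingAut.mul_apply, RingAut.mul_apply, ih]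
    exact congrArg _ (Function.Commute.iterate_left hδσ i a)

/-- Moving a power of `ξ` past a coefficient, summed over the antidiagonal. -/
theorem pow_mul_map_eq_sum_antidiagonal {A B : Type*} [Ring A] [Ring B]
    (σ : A ≃+* A) (δ : A → A) (hδσ : ∀ a : A, δ (σ a) = σ (δ a))
    (f : A →+* B) (ξ : B) (hξ : ∀ a : A, ξ * f a = f (σ a) * ξ + f (δ a)) (n : ℕ) (b : A) :
    ξ ^ n * f b = ∑ ij ∈ Finset.HasAntidiagonal.antidiagonal n,
      n.choose ij.1 • (f ((σ ^ ij.2) (δ^[ij.1] b)) * ξ ^ ij.2) := by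
  induction n generalizing b with
  | zero => simp
  | succ n ih =>
    rw [Finset.sum_antidiagonal_choose_succ_nsmul
      (fun i j => f ((σ ^ j) (δ^[i] b)) * ξ ^ j) n, pow_succ, mul_assoc, hξ, mul_add,
      ← mul_assoc, ih, ih, Finset.sum_mul]
    congr 1
    · refine Finset.sum_congr rfl fun ij _ => ?_
      have h : δ^[ij.1] (σ b) = σ (δ^[ij.1] b) := Function.Commute.iterate_left hδσ ij.1 b
      rw [smul_mul_assoc, mul_assoc, ← pow_succ, h, pow_succ σ, RingAut.mul_apply]
    · refine Finset.sum_congr rfl fun ij hij => ?_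
      rw [Nat.choose_symm_of_eq_add (Finset.HasAntidiagonal.mem_antidiagonal.mp hij).symm,
        Function.iterate_succ_apply]

/-- Moving a power of `ξ` past a coefficient, summed over a range. -/
theorem pow_mul_map_eq_sum_range {A B : Type*} [Ring A] [Ring B]
    (σ : A ≃+* A) (δ : A → A) (hδσ : ∀ a : A, δ (σ a) = σ (δ a))
    (f : A →+* B) (ξ : B) (hξ : ∀ a : A, ξ * f a = f (σ a) * ξ + f (δ a)) (n : ℕ) (b : A) :
    ξ ^ n * f b = ∑ i ∈ Finset.range (n + 1),
      n.choose i • (f ((σ ^ (n - i)) (δ^[i] b)) * ξ ^ (n - i)) := by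
  rw [pow_mul_map_eq_sum_antidiagonal σ δ hδσ f ξ hξ, Finset.Nat.sum_antidiagonal_eq_sum_range_succ
    (fun i j => n.choose i • (f ((σ ^ j) (δ^[i] b)) * ξ ^ j))]

/-- Product formula in the two-dimensional algebra of formal twisted
differential symbols:
`f a * ξ₁^m ξ₂^n * f b * ξ₁^p ξ₂^q
  = ∑_{i=0}^{m} ∑_{j=0}^{n} C(m,i) C(n,j)
      f (a * σ^{m+n-i-j} (δ₁^[i] (δ₂^[j] b))) * ξ₁^{m+p-i} ξ₂^{n+q-j}`. -/
theorem two_dim_symbols_product_formula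
    {A B : Type*} [Ring A] [Ring B]
    (σ : A ≃+* A) (δ₁ δ₂ : A → A)
    (hδ₁add : ∀ a b : A, δ₁ (a + b) = δ₁ a + δ₁ b)
    (hδ₂add : ∀ a b : A, δ₂ (a + b) = δ₂ a + δ₂ b)
    (hδ₁mul : ∀ a b : A, δ₁ (a * b) = δ₁ a * b + σ a * δ₁ b)
    (hδ₂mul : ∀ a b : A, δ₂ (a * b) = δ₂ a * b + σ a * δ₂ b)
    (hδδ : ∀ a : A, δ₁ (δ₂ a) = δ₂ (δ₁ a))
    (hδ₁σ : ∀ a : A, δ₁ (σ a) = σ (δ₁ a))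
    (hδ₂σ : ∀ a : A, δ₂ (σ a) = σ (δ₂ a))
    (f : A →+* B) (ξ₁ ξ₂ : B)
    (hξξ : ξ₁ * ξ₂ = ξ₂ * ξ₁)
    (hξ₁ : ∀ a : A, ξ₁ * f a = f (σ a) * ξ₁ + f (δ₁ a))
    (hξ₂ : ∀ a : A, ξ₂ * f a = f (σ a) * ξ₂ + f (δ₂ a)) :
    ∀ (m n p q : ℕ) (a b : A),
      f a * (ξ₁ ^ m * ξ₂ ^ n) * (f b * (ξ₁ ^ p * ξ₂ ^ q)) =
        ∑ i ∈ Finset.range (m + 1), ∑ j ∈ Finset.range (n + 1),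
          (m.choose i : B) * (n.choose j : B) *
            f (a * (σ ^ (m + n - i - j)) (δ₁^[i] (δ₂^[j] b))) *
            (ξ₁ ^ (m + p - i) * ξ₂ ^ (n + q - j)) := by
  intro m n p q a b
  have expand : ξ₁ ^ m * (ξ₂ ^ n * f b) =
      ∑ i ∈ Finset.range (m + 1), ∑ j ∈ Finset.range (n + 1),
        (m.choose i * n.choose j) • (f ((σ ^ (m + n - i - j)) (δ₁^[i] (δ₂^[j] b))) *
          (ξ₁ ^ (m - i) * ξ₂ ^ (n - j))) := by
    rw [pow_mul_map_eq_sum_range σ δ₂ hδ₂σ f ξ₂ hξ₂, Finset.mul_sum, Finset.sum_comm]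
    refine Finset.sum_congr rfl fun j hj => ?_
    rw [mul_smul_comm, ← mul_assoc, pow_mul_map_eq_sum_range σ δ₁ hδ₁σ f ξ₁ hξ₁,
      Finset.sum_mul, Finset.smul_sum]
    refine Finset.sum_congr rfl fun i hi => ?_
    have hi' := Finset.mem_range.mp hi
    have hj' := Finset.mem_range.mp hj
    have hexp : m + n - i - j = (m - i) + (n - j) := by omega
    rw [iterate_ringEquiv_pow_apply σ δ₁ hδ₁σ, hexp, pow_add σ, RingAut.mul_apply,
      smul_mul_assoc, smul_smul, mul_comm (n.choose j), mul_assoc]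
  have regroup : f a * (ξ₁ ^ m * ξ₂ ^ n) * (f b * (ξ₁ ^ p * ξ₂ ^ q)) =
      f a * (ξ₁ ^ m * (ξ₂ ^ n * f b)) * (ξ₁ ^ p * ξ₂ ^ q) := by
    simp only [mul_assoc]
  rw [regroup, expand, Finset.mul_sum, Finset.sum_mul]
  refine Finset.sum_congr rfl fun i hi => ?_
  rw [Finset.mul_sum, Finset.sum_mul]
  refine Finset.sum_congr rfl fun j hj => ?_
  have hi' := Finset.mem_range.mp hi
  have hj' := Finset.mem_range.mp hj
  have hp : m + p - i = (m - i) + p := by omega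
  have hq : n + q - j = (n - j) + q := by omega
  have hcomm : ξ₂ ^ (n - j) * ξ₁ ^ p = ξ₁ ^ p * ξ₂ ^ (n - j) :=
    (Commute.pow_pow hξξ p (n - j)).symm.eq
  have hpow : ξ₁ ^ (m - i) * ξ₂ ^ (n - j) * (ξ₁ ^ p * ξ₂ ^ q) =
      ξ₁ ^ (m + p - i) * ξ₂ ^ (n + q - j) := by
    rw [hp, hq, pow_add, pow_add, mul_assoc, ← mul_assoc (ξ₂ ^ (n - j)), hcomm]
    simp only [mul_assoc]
  rw [← hpow, map_mul, mul_smul_comm, smul_mul_assoc, nsmul_eq_mul, Nat.cast_mul]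
  simp only [mul_assoc]
end

section
/- (Lemma 4.2) Let A be a unital associative algebra over ℂ, σ : A → A an algebra automorphism, and δ : A → A a σ-derivation such that δ∘σ = σ∘δ. If τ : A → ℂ is a linear functional with τ∘δ = 0, then for all a, b ∈ A and every natural number i one has τ(δ^i(a)·b) = (−1)^i · τ(σ^i(a)·δ^i(b)), where δ^i and σ^i denote i-th iterates. -/
/-- Lemma 4.2: If `δ` is a `σ`-derivation on a unital ℂ-algebra `A` commuting
with `σ`, and `τ` is a linear functional with `τ ∘ δ = 0`, then for every natural number `i`,
`τ (δ^i a * b) = (-1)^i * τ (σ^i a * δ^i b)`. -/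
theorem twisted_integration_by_parts
    {A : Type*} [Ring A] [Algebra ℂ A]
    (σ : A ≃ₐ[ℂ] A) (δ : A →ₗ[ℂ] A)
    (hδmul : ∀ a b : A, δ (a * b) = δ a * b + σ a * δ b)
    (hδσ : ∀ a : A, δ (σ a) = σ (δ a))
    (τ : A →ₗ[ℂ] ℂ)
    (hτδ : ∀ a : A, τ (δ a) = 0) :
    ∀ (a b : A) (i : ℕ),
      τ ((δ ^ i) a * b) = (-1 : ℂ) ^ i * τ ((σ ^ i) a * (δ ^ i) b) := by
  have parts (a b : A) : τ (δ a * b) = -τ (σ a * δ b) :=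
    eq_neg_of_add_eq_zero_left (by rw [← map_add, ← hδmul, hτδ])
  have comm (i : ℕ) (a : A) : (σ ^ i) (δ a) = δ ((σ ^ i) a) := by
    induction i with
    | zero => rfl
    | succ i ih => rw [pow_succ', AlgEquiv.mul_apply, AlgEquiv.mul_apply, ih, hδσ]
  intro a b i
  induction i generalizing a with
  | zero => simp
  | succ i ih =>
    rw [pow_succ, Module.End.mul_apply, ih, comm, parts, ← AlgEquiv.mul_apply, ← pow_succ',
      ← Module.End.mul_apply, ← pow_succ', ← pow_succ]
    ring
end

section
/- Let A be a unital associative algebra over ℂ, σ : A → A an algebra automorphism, and δ₁, δ₂ : A → A two σ-derivations such that δ₁∘δ₂ = δ₂∘δ₁, δ₁∘σ = σ∘δ₁, and δ₂∘σ = σ∘δ₂. Let τ : A → ℂ be a linear functional such that τ∘δ₁ = 0, τ∘δ₂ = 0, τ∘σ = τ, and τ is a σ²-trace, i.e. τ(xy) = τ(σ²(y)·x) for all x,y ∈ A. Then for all a, b ∈ A, all natural numbers i, j, and every integer k one has τ( b · σ^k(δ₁^i(δ₂^j(a))) ) = (−1)^{i+j} · τ( a · σ^{−k−i−j−2}(δ₁^i(δ₂^j(b)))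 ), where σ^k denotes the k-th power of σ in the automorphism group of A (negative powers being powers of σ^{-1}). -/
section TwistedTrace

variable {A : Type*} [Ring A] [Algebra ℂ A] {σ : A ≃ₐ[ℂ] A} {δ : A →ₗ[ℂ] A} {τ : A →ₗ[ℂ] ℂ}

/-- A linear map commuting with an automorphism commutes with all its integer powers. -/
theorem map_zpow_apply_of_map_apply (hδσ : ∀ a, δ (σ a) = σ (δ a)) (k : ℤ) (a : A) :
    δ ((σ ^ k) a) = (σ ^ k) (δ a) := by
  induction k generalizing a with
  | zero => simp
  | succ n ih => rw [zpow_add_one, AlgEquiv.mul_apply, AlgEquiv.mul_apply, ih, hδσ]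
  | pred n ih =>
    have hinv : δ (σ⁻¹ a) = σ⁻¹ (δ a) := by
      apply σ.injective
      rw [← hδσ, ← AlgEquiv.mul_apply, ← AlgEquiv.mul_apply, mul_inv_cancel,
        AlgEquiv.one_apply, AlgEquiv.one_apply]
    rw [zpow_sub_one, AlgEquiv.mul_apply, AlgEquiv.mul_apply, ih, hinv]

/-- A functional invariant under an automorphism is invariant under all its integer powers. -/
theorem apply_zpow_of_apply (hτσ : ∀ a, τ (σ a) = τ a) (k : ℤ) (a : A) :
    τ ((σ ^ k) a) = τ a := by
  induction k generalizing a with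
  | zero => simp
  | succ n ih => rw [zpow_add_one, AlgEquiv.mul_apply, ih, hτσ]
  | pred n ih =>
    rw [zpow_sub_one, AlgEquiv.mul_apply, ih, ← hτσ, ← AlgEquiv.mul_apply, mul_inv_cancel,
      AlgEquiv.one_apply]

/-- Integration by parts for a twisted derivation. -/
theorem trace_mul_zpow_twistedDerivation
    (hmul : ∀ a b, δ (a * b) = δ a * b + σ a * δ b) (hδσ : ∀ a, δ (σ a) = σ (δ a))
    (hτδ : ∀ a, τ (δ a) = 0) (hτσ : ∀ a, τ (σ a) = τ a) (k : ℤ) (a b : A) :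
    τ (b * (σ ^ k) (δ a)) = -τ (δ b * (σ ^ (k + 1)) a) := by
  have h := hτδ (b * (σ ^ (k + 1)) a)
  rw [hmul, map_add, map_zpow_apply_of_map_apply hδσ, add_comm k 1, zpow_one_add,
    AlgEquiv.mul_apply, AlgEquiv.mul_apply, ← map_mul, hτσ] at h
  rw [add_comm k 1, zpow_one_add, AlgEquiv.mul_apply]
  exact eq_neg_of_add_eq_zero_right h

/-- Iterated integration by parts for a twisted derivation. -/
theorem trace_mul_zpow_twistedDerivation_pow
    (hmul : ∀ a b, δ (a * b) = δ a * b + σ a * δ b) (hδσ : ∀ a, δ (σ a) = σ (δ a))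
    (hτδ : ∀ a, τ (δ a) = 0) (hτσ : ∀ a, τ (σ a) = τ a) (i : ℕ) (k : ℤ) (a b : A) :
    τ (b * (σ ^ k) ((δ ^ i) a)) = (-1) ^ i * τ ((δ ^ i) b * (σ ^ (k + i)) a) := by
  induction i generalizing k b with
  | zero => simp
  | succ n ih =>
    rw [pow_succ' δ, Module.End.mul_apply, trace_mul_zpow_twistedDerivation hmul hδσ hτδ hτσ,
      ih, ← pow_succ' δ, pow_succ δ, Module.End.mul_apply, Nat.cast_succ, add_assoc k 1,
      add_comm (1 : ℤ), pow_succ]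
    ring

/-- A `σ`-invariant `σ²`-trace allows the two factors to be exchanged. -/
theorem trace_mul_zpow_swap (hτσ : ∀ a, τ (σ a) = τ a)
    (hτtrace : ∀ x y, τ (x * y) = τ (σ (σ y) * x)) (k : ℤ) (a b : A) :
    τ (b * (σ ^ k) a) = τ (a * (σ ^ (-k - 2)) b) := by
  rw [hτtrace, ← apply_zpow_of_apply hτσ (-k - 2), map_mul, ← AlgEquiv.mul_apply,
    ← AlgEquiv.mul_apply, ← AlgEquiv.mul_apply, ← zpow_add_one,
    ← zpow_add_one, ← zpow_add, show -k - 2 + 1 + 1 + k = 0 by ring, zpow_zero,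
    AlgEquiv.one_apply]

end TwistedTrace

/-- For a ℂ-algebra automorphism `σ`, commuting `σ`-derivations `δ₁, δ₂`
commuting with `σ`, and a `σ²`-trace `τ` with `τ ∘ δ₁ = τ ∘ δ₂ = 0` and `τ ∘ σ = τ`,
one has, for all `a, b ∈ A`, natural numbers `i, j` and every integer `k`,
`τ (b * σ^k (δ₁^i (δ₂^j a))) = (-1)^{i+j} * τ (a * σ^{-k-i-j-2} (δ₁^i (δ₂^j b)))`. -/
theorem twisted_trace_shuffle
    {A : Type*} [Ring A] [Algebra ℂ A]
    (σ : A ≃ₐ[ℂ] A) (δ₁ δ₂ : A →ₗ[ℂ] A)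
    (hδ₁mul : ∀ a b : A, δ₁ (a * b) = δ₁ a * b + σ a * δ₁ b)
    (hδ₂mul : ∀ a b : A, δ₂ (a * b) = δ₂ a * b + σ a * δ₂ b)
    (hδδ : ∀ a : A, δ₁ (δ₂ a) = δ₂ (δ₁ a))
    (hδ₁σ : ∀ a : A, δ₁ (σ a) = σ (δ₁ a))
    (hδ₂σ : ∀ a : A, δ₂ (σ a) = σ (δ₂ a))
    (τ : A →ₗ[ℂ] ℂ)
    (hτδ₁ : ∀ a : A, τ (δ₁ a) = 0)
    (hτδ₂ : ∀ a : A, τ (δ₂ a) = 0)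
    (hτσ : ∀ a : A, τ (σ a) = τ a)
    (hτtrace : ∀ x y : A, τ (x * y) = τ (σ (σ y) * x)) :
    ∀ (a b : A) (i j : ℕ) (k : ℤ),
      τ (b * (σ ^ k) ((δ₁ ^ i) ((δ₂ ^ j) a))) =
        (-1 : ℂ) ^ (i + j) *
          τ (a * (σ ^ (-k - i - j - 2)) ((δ₁ ^ i) ((δ₂ ^ j) b))) := by
  intro a b i j k
  have hcomm : (δ₂ ^ j) ((δ₁ ^ i) b) = (δ₁ ^ i) ((δ₂ ^ j) b) := by
    have h : Commute δ₁ δ₂ := LinearMap.ext hδδ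
    exact (LinearMap.congr_fun (h.pow_pow i j).eq b).symm
  rw [trace_mul_zpow_twistedDerivation_pow hδ₁mul hδ₁σ hτδ₁ hτσ,
    trace_mul_zpow_twistedDerivation_pow hδ₂mul hδ₂σ hτδ₂ hτσ,
    trace_mul_zpow_swap hτσ hτtrace, hcomm, ← mul_assoc, ← pow_add,
    show -(k + i + j) - 2 = -k - i - j - 2 by ring]
end

section
/- (Theorem 4.3, coefficient form) Let A be a unital associative algebra over ℂ, σ : A → A an algebra automorphism, and δ₁, δ₂ : A → A two σ-derivations such that δ₁∘δ₂ = δ₂∘δ₁, δ₁∘σ = σ∘δ₁, and δ₂∘σ = σ∘δ₂. Let τ : A → ℂ be a linear functional such that τ∘δ₁ = 0, τ∘δ₂ = 0, τ∘σ = τ, and τ is a σ²-trace, i.e. τ(xy) = τ(σ²(y)·x) for all x,y ∈ A. Let m, n, p, q ∈ ℤ and suppose i := m + p + 1 ≥ 0 and j := n + q + 1 ≥ 0. Then for all a, b ∈ A: C(m,i)·C(n,j) · τ( a · σ^{m+n−i−j}(δ₁^i(δ₂^j(b))) ) = C(p,i)·C(q,j) · τ( b · σ^{p+q−i−j}(δ₁^i(δ₂^j(a)))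 ), where C(·,·) are generalized binomial coefficients with integer upper argument and σ^k denotes the k-th (possibly negative) power of the automorphism σ. (This equality expresses that the noncommutative residue Res(Σ a_{m,n} ξ₁^m ξ₂^n) = τ(a_{−1,−1}) is a trace on the algebra of two dimensional formal twisted pseudodifferential symbols Ψ(A,σ,δ₁,δ₂): it states Res(a ξ₁^m ξ₂^n · b ξ₁^p ξ₂^q) = Res(b ξ₁^p ξ₂^q · a ξ₁^m ξ₂^n).) -/
/-- A map commuting with an automorphism commutes with all its integer powers. -/
theorem apply_zpow_of_commute {A : Type*} [Ring A] [Algebra ℂ A] (σ : A ≃ₐ[ℂ] A)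
    {f : A → A} (hf : ∀ a, f (σ a) = σ (f a)) (k : ℤ) (a : A) :
    f ((σ ^ k) a) = (σ ^ k) (f a) := by
  induction k generalizing a with
  | zero => simp
  | succ k ih => rw [zpow_add_one, AlgEquiv.mul_apply, AlgEquiv.mul_apply, ih, hf]
  | pred k ih =>
    have hinv : f (σ⁻¹ a) = σ⁻¹ (f a) := by
      apply σ.injective
      rw [← hf, ← AlgEquiv.mul_apply, ← AlgEquiv.mul_apply]
      simp
    rw [zpow_sub_one, AlgEquiv.mul_apply, AlgEquiv.mul_apply, ih, hinv]

/-- A functional invariant under an automorphism is invariant under all its integer powers. -/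
theorem apply_zpow_of_invariant {A : Type*} [Ring A] [Algebra ℂ A] (σ : A ≃ₐ[ℂ] A)
    {τ : A → ℂ} (hτ : ∀ a, τ (σ a) = τ a) (k : ℤ) (a : A) :
    τ ((σ ^ k) a) = τ a := by
  induction k generalizing a with
  | zero => simp
  | succ k ih => rw [zpow_add_one, AlgEquiv.mul_apply, ih, hτ]
  | pred k ih =>
    rw [zpow_sub_one, AlgEquiv.mul_apply, ih, ← hτ (σ⁻¹ a), ← AlgEquiv.mul_apply]
    simp

/-- The powers of a linear map commute with whatever the map commutes with. -/
theorem pow_apply_comm_of_commute {A : Type*} [Ring A] [Algebra ℂ A] {f : A → A}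
    {δ : A →ₗ[ℂ] A} (h : ∀ a, δ (f a) = f (δ a)) (i : ℕ) (a : A) :
    (δ ^ i) (f a) = f ((δ ^ i) a) := by
  induction i generalizing a with
  | zero => simp
  | succ i ih => rw [pow_succ, Module.End.mul_apply, Module.End.mul_apply, h, ih]

/-- Iterated integration by parts for a twisted derivation annihilated by a functional. -/
theorem integration_by_parts_pow {A : Type*} [Ring A] [Algebra ℂ A] (σ : A ≃ₐ[ℂ] A)
    {δ : A →ₗ[ℂ] A} (hmul : ∀ a b : A, δ (a * b) = δ a * b + σ a * δ b)
    (hδσ : ∀ a : A, δ (σ a) = σ (δ a)) {τ : A →ₗ[ℂ] ℂ} (hτδ : ∀ a : A, τ (δ a) = 0)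
    (i : ℕ) (x y : A) :
    τ ((σ ^ (i : ℤ)) x * (δ ^ i) y) = (-1) ^ i * τ ((δ ^ i) x * y) := by
  induction i generalizing x y with
  | zero => simp
  | succ i ih =>
    have hparts : τ (σ ((δ ^ i) x) * δ y) = -τ (δ ((δ ^ i) x) * y) := by
      have h := hτδ ((δ ^ i) x * y)
      rw [hmul, map_add] at h
      linear_combination h
    rw [Nat.cast_succ, zpow_add_one, AlgEquiv.mul_apply, pow_succ δ, Module.End.mul_apply, ih,
      pow_apply_comm_of_commute hδσ, hparts, ← pow_succ δ, pow_succ' δ, Module.End.mul_apply,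
      pow_succ]
    ring

/-- Reflection of the upper argument of a generalized binomial coefficient. -/
theorem Ring.choose_reflect {m p : ℤ} {i : ℕ} (h : (i : ℤ) = m + p + 1) :
    Ring.choose m i = (-1) ^ i * Ring.choose p i := by
  have hm : m = -(p + 1 - i) := by omega
  rw [hm, Ring.choose_neg, Units.smul_def, Int.coe_negOnePow_natCast, smul_eq_mul]
  congr 2
  ring


/-- Theorem 4.3, coefficient form: With `σ` a ℂ-algebra automorphism,
`δ₁, δ₂` commuting `σ`-derivations commuting with `σ`, and `τ` a `σ²`-trace with
`τ ∘ δ₁ = τ ∘ δ₂ = 0` and `τ ∘ σ = τ`, for integers `m, n, p, q` with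
`i := (m+p+1).toNat` and `j := (n+q+1).toNat` (assuming `m+p+1 ≥ 0`, `n+q+1 ≥ 0`):
`C(m,i) C(n,j) τ (a * σ^{m+n-i-j} (δ₁^i (δ₂^j b)))
  = C(p,i) C(q,j) τ (b * σ^{p+q-i-j} (δ₁^i (δ₂^j a)))`,
expressing the tracial property of the noncommutative residue on `Ψ(A,σ,δ₁,δ₂)`. -/
theorem two_dim_residue_is_trace
    {A : Type*} [Ring A] [Algebra ℂ A]
    (σ : A ≃ₐ[ℂ] A) (δ₁ δ₂ : A →ₗ[ℂ] A)
    (hδ₁mul : ∀ a b : A, δ₁ (a * b) = δ₁ a * b + σ a * δ₁ b)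
    (hδ₂mul : ∀ a b : A, δ₂ (a * b) = δ₂ a * b + σ a * δ₂ b)
    (hδδ : ∀ a : A, δ₁ (δ₂ a) = δ₂ (δ₁ a))
    (hδ₁σ : ∀ a : A, δ₁ (σ a) = σ (δ₁ a))
    (hδ₂σ : ∀ a : A, δ₂ (σ a) = σ (δ₂ a))
    (τ : A →ₗ[ℂ] ℂ)
    (hτδ₁ : ∀ a : A, τ (δ₁ a) = 0)
    (hτδ₂ : ∀ a : A, τ (δ₂ a) = 0)
    (hτσ : ∀ a : A, τ (σ a) = τ a)
    (hτtrace : ∀ x y : A, τ (x * y) = τ (σ (σ y) * x))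
    (m n p q : ℤ) (hi : 0 ≤ m + p + 1) (hj : 0 ≤ n + q + 1)
    (i j : ℕ) (hidef : (i : ℤ) = m + p + 1) (hjdef : (j : ℤ) = n + q + 1)
    (a b : A) :
    ((Ring.choose m i * Ring.choose n j : ℤ) : ℂ) *
        τ (a * (σ ^ (m + n - i - j)) ((δ₁ ^ i) ((δ₂ ^ j) b))) =
      ((Ring.choose p i * Ring.choose q j : ℤ) : ℂ) *
        τ (b * (σ ^ (p + q - i - j)) ((δ₁ ^ i) ((δ₂ ^ j) a))) := by

  have hx : a = (σ ^ (i : ℤ)) ((σ ^ (j : ℤ)) ((σ ^ (-(i : ℤ) - j)) a)) := by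
    rw [← AlgEquiv.mul_apply, ← AlgEquiv.mul_apply, ← zpow_add, ← zpow_add]
    simp
  have hparts : τ (a * (σ ^ (m + n - i - j)) ((δ₁ ^ i) ((δ₂ ^ j) b))) =
      (-1) ^ i * (-1) ^ j * τ (b * (σ ^ (p + q - i - j)) ((δ₁ ^ i) ((δ₂ ^ j) a))) := by
    have hcomm (x : A) : (δ₂ ^ j) ((δ₁ ^ i) x) = (δ₁ ^ i) ((δ₂ ^ j) x) :=
      (pow_apply_comm_of_commute (f := ⇑(δ₂ ^ j))
        (fun x => (pow_apply_comm_of_commute (fun x => (hδδ x).symm) j x).symm) i x).symm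
    have h₁ (k : ℤ) := apply_zpow_of_commute σ (pow_apply_comm_of_commute hδ₁σ i) k
    have h₂ (k : ℤ) := apply_zpow_of_commute σ (pow_apply_comm_of_commute hδ₂σ j) k
    conv_lhs => rw [hx]
    rw [← h₁, ← h₂, integration_by_parts_pow σ hδ₁mul hδ₁σ hτδ₁, h₁,
      integration_by_parts_pow σ hδ₂mul hδ₂σ hτδ₂, hcomm, h₂, h₁, hτtrace, ← mul_assoc,
      ← apply_zpow_of_invariant σ hτσ (-(m + n - i - j) - 2), map_mul]
    congr 3
    · rw [← AlgEquiv.mul_apply σ σ, ← pow_two, ← zpow_natCast, ← AlgEquiv.mul_apply,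
        ← AlgEquiv.mul_apply, ← zpow_add, ← zpow_add]
      simp
    · rw [← AlgEquiv.mul_apply, ← zpow_add]
      congr 2
      omega
  have hsign (k : ℕ) : ((-1 : ℂ) ^ k) * (-1) ^ k = 1 := by
    rw [← mul_pow]
    simp
  rw [hparts, Ring.choose_reflect hidef, Ring.choose_reflect hjdef]
  push_cast
  linear_combination (Ring.choose p i * Ring.choose q j : ℂ) *
    τ (b * (σ ^ (p + q - i - j)) ((δ₁ ^ i) ((δ₂ ^ j) a))) *
    ((-1) ^ j * (-1) ^ j * hsign i + hsign j)
end

section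
/- (Adler–Manin trace, coefficient form) Let A be a unital associative algebra over ℂ and δ : A → A a derivation. Let τ : A → ℂ be a linear functional which is a trace (τ(xy) = τ(yx) for all x,y ∈ A) and satisfies τ∘δ = 0. Let m, p ∈ ℤ and suppose k := m + p + 1 ≥ 0. Then for all a, b ∈ A: C(m,k) · τ( a · δ^k(b) ) = C(p,k) · τ( b · δ^k(a) ), where C(·,·) is the generalized binomial coefficient with integer upper argument. (This equality expresses that the Adler–Manin noncommutative residue res(Σ a_i ξ^i) = τ(a_{−1}) is a trace on the algebra of formal pseudodifferential symbols Ψ(A,δ): it states res(a ξ^m · b ξ^p) = res(b ξ^p · a ξ^m).) -/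
/-- Repeated integration by parts for a functional vanishing on the image of a derivation. -/
theorem map_mul_pow_derivation {R A M : Type*} [CommRing R] [Ring A] [Algebra R A]
    [AddCommGroup M] [Module R M] (δ : A →ₗ[R] A)
    (hδmul : ∀ a b : A, δ (a * b) = δ a * b + a * δ b)
    (τ : A →ₗ[R] M) (hτδ : ∀ a : A, τ (δ a) = 0) (k : ℕ) (a b : A) :
    τ (a * (δ ^ k) b) = (-1 : R) ^ k • τ ((δ ^ k) a * b) := by
  induction k generalizing a with
  | zero => simp
  | succ k ih =>
    have parts := hτδ (a * (δ ^ k) b)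
    rw [hδmul, map_add] at parts
    rw [pow_succ' δ, Module.End.mul_apply, eq_neg_of_add_eq_zero_right parts, ih,
      ← pow_succ' δ, pow_succ δ, Module.End.mul_apply, pow_succ, mul_neg_one, neg_smul]

/-- Reflection of the upper argument of an integer binomial coefficient. -/
theorem Int.ringChoose_reflect {m p : ℤ} {k : ℕ} (h : (k : ℤ) = m + p + 1) :
    Ring.choose p k = (-1) ^ k * Ring.choose m k := by
  have reflect := Ring.choose_neg (-p) k
  rw [neg_neg, show -p + (k : ℤ) - 1 = m by lia] at reflect
  simpa [Int.negOnePow_def, Units.smul_def] using reflect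

/-- Adler–Manin trace, coefficient form: For a derivation `δ` on a unital
ℂ-algebra `A` and a `δ`-invariant trace `τ`, for integers `m, p` with `k := m + p + 1 ≥ 0`:
`C(m,k) τ (a * δ^k b) = C(p,k) τ (b * δ^k a)`,
expressing the tracial property of the Adler–Manin noncommutative residue on `Ψ(A,δ)`. -/
theorem adler_manin_residue_is_trace
    {A : Type*} [Ring A] [Algebra ℂ A]
    (δ : A →ₗ[ℂ] A)
    (hδmul : ∀ a b : A, δ (a * b) = δ a * b + a * δ b)
    (τ : A →ₗ[ℂ] ℂ)
    (hτtrace : ∀ x y : A, τ (x * y) = τ (y * x))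
    (hτδ : ∀ a : A, τ (δ a) = 0)
    (m p : ℤ) (hk : 0 ≤ m + p + 1)
    (k : ℕ) (hkdef : (k : ℤ) = m + p + 1)
    (a b : A) :
    ((Ring.choose m k : ℤ) : ℂ) * τ (a * (δ ^ k) b) =
      ((Ring.choose p k : ℤ) : ℂ) * τ (b * (δ ^ k) a) := by
  rw [Int.ringChoose_reflect hkdef, map_mul_pow_derivation δ hδmul τ hτδ, hτtrace _ b]
  push_cast
  rw [smul_eq_mul]
  ring
end
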